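/- Let T be a Kreiss bounded operator on L^p(Ω,μ) with 1 < p < ∞. Then ‖T^n‖ = O(n/√(log n)). -/

import Mathlib

open MeasureTheory Filter Asymptotics Finset

/-- `T` is Kreiss bounded: the resolvent `(λI - T)⁻¹` exists for `|λ| > 1` and satisfies
the Kreiss resolvent condition. -/
def KreissBounded {X : Type} [NormedAddCommGroup X] [NormedSpace ℂ X]
    (T : X →L[ℂ] X) : Prop :=
  ∃ C : ℝ, 0 < C ∧ ∀ lam : ℂ, 1 < ‖lam‖ →
    IsUnit (lam • (1 : X →L[ℂ] X) - T) ∧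
    ‖Ring.inverse (lam • (1 : X →L[ℂ] X) - T)‖ ≤ C / (‖lam‖ - 1)

/-- A normed space is 2-uniformly smooth with constant `K`. -/
def TwoSmooth (X : Type*) [NormedAddCommGroup X] (K : ℝ) : Prop :=
  ∀ x y : X, ‖x + y‖ ^ 2 + ‖x - y‖ ^ 2 ≤ 2 * ‖x‖ ^ 2 + 2 * K * ‖y‖ ^ 2

theorem rpow_add_rpow_le_exp {s t q : ℝ} (hs : 0 < s) (hq : 0 ≤ q) (ht : |t| ≤ s) :
    (s + t) ^ q + (s - t) ^ q ≤ 2 * (s * Real.exp (q * t ^ 2 / (2 * s ^ 2))) ^ q := by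
  have key : ∀ r : ℝ, |r| ≤ s → (s + r) ^ q ≤ s ^ q * Real.exp (q * (r / s)) := by
    intro r hr
    have h0 : 0 ≤ s + r := by linarith [(abs_le.1 hr).1]
    have h1 : s + r ≤ s * Real.exp (r / s) := by
      have := mul_le_mul_of_nonneg_left (Real.add_one_le_exp (r / s)) hs.le
      have h2 : s * (r / s + 1) = s + r := by field_simp; ring
      linarith
    calc (s + r) ^ q ≤ (s * Real.exp (r / s)) ^ q := Real.rpow_le_rpow h0 h1 hq
      _ = s ^ q * Real.exp (q * (r / s)) := by
        rw [Real.mul_rpow hs.le (Real.exp_pos _).le, ← Real.exp_mul, mul_comm q]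
  have h1 := key t ht
  have h2 := key (-t) (by rwa [abs_neg])
  have h3 := Real.cosh_le_exp_half_sq (q * (t / s))
  rw [Real.cosh_eq] at h3
  have h4 : Real.exp ((q * (t / s)) ^ 2 / 2) = Real.exp (q * t ^ 2 / (2 * s ^ 2)) ^ q := by
    rw [← Real.exp_mul]; congr 1; field_simp
  rw [Real.mul_rpow hs.le (Real.exp_pos _).le, ← h4]
  have h5 : q * (-t / s) = -(q * (t / s)) := by ring
  rw [h5] at h2
  have h6 := mul_le_mul_of_nonneg_left h3 (Real.rpow_nonneg hs.le q)
  rw [sub_eq_add_neg]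
  linarith

theorem exp_mul_le_of_mem_unitInterval {c v : ℝ} (h0 : 0 ≤ v) (h1 : v ≤ 1) :
    Real.exp (c * v) ≤ 1 + (Real.exp c - 1) * v := by
  have := convexOn_exp.2 (Set.mem_univ 0) (Set.mem_univ c) (sub_nonneg.2 h1) h0 (by ring)
  simp only [smul_eq_mul, mul_zero, zero_add, Real.exp_zero] at this
  rw [mul_comm c]; linarith

theorem norm_add_rpow_add_norm_sub_rpow_le {E : Type*} [NormedAddCommGroup E]
    [InnerProductSpace ℝ E] (a b : E) {q : ℝ} (hq : 1 ≤ q) :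
    ‖a + b‖ ^ (2 * q) + ‖a - b‖ ^ (2 * q) ≤
      2 * (‖a‖ ^ 2 + Real.exp (2 * q) * ‖b‖ ^ 2) ^ q := by
  rcases eq_or_ne b 0 with rfl | hb
  · simp [Real.rpow_mul (norm_nonneg a), two_mul (_ ^ q)]
  have hb' := norm_pos_iff.2 hb
  set s := ‖a‖ ^ 2 + ‖b‖ ^ 2 with hs
  have hs0 : 0 < s := by positivity
  set t := 2 * inner ℝ a b with ht
  have hin := abs_real_inner_le_norm a b
  have ht2 : t ^ 2 ≤ 4 * (‖a‖ ^ 2 * ‖b‖ ^ 2) := by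
    have := sq_le_sq' (by linarith [abs_nonneg (inner ℝ a b), (abs_le.1 hin).1]) (abs_le.1 hin).2
    rw [ht]; nlinarith
  have hts : |t| ≤ s := by
    rw [ht, abs_mul, abs_two]; nlinarith [sq_nonneg (‖a‖ - ‖b‖)]
  have e1 : ‖a + b‖ ^ (2 * q) = (s + t) ^ q := by
    rw [Real.rpow_mul (norm_nonneg _), Real.rpow_two, norm_add_sq_real]; congr 1; ring
  have e2 : ‖a - b‖ ^ (2 * q) = (s - t) ^ q := by
    rw [Real.rpow_mul (norm_nonneg _), Real.rpow_two, norm_sub_sq_real]; congr 1; ring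
  rw [e1, e2]
  refine (rpow_add_rpow_le_exp hs0 (by linarith) hts).trans ?_
  gcongr
  have hv1 : ‖b‖ ^ 2 / s ≤ 1 := by rw [div_le_one hs0]; nlinarith [sq_nonneg ‖a‖]
  have h1 : q * t ^ 2 / (2 * s ^ 2) ≤ (2 * q) * (‖b‖ ^ 2 / s) := by
    rw [← mul_div_assoc, div_le_div_iff₀ (by positivity) hs0]
    have : t ^ 2 ≤ 4 * (s * ‖b‖ ^ 2) := by nlinarith [sq_nonneg (‖b‖ ^ 2)]
    calc q * t ^ 2 * s ≤ q * (4 * (s * ‖b‖ ^ 2)) * s := by gcongr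
      _ = _ := by ring
  have h2 := exp_mul_le_of_mem_unitInterval (c := 2 * q) (v := ‖b‖ ^ 2 / s) (by positivity) hv1
  calc s * Real.exp (q * t ^ 2 / (2 * s ^ 2))
      ≤ s * (1 + (Real.exp (2 * q) - 1) * (‖b‖ ^ 2 / s)) := by
        gcongr; exact (Real.exp_le_exp.2 h1).trans h2
    _ = ‖a‖ ^ 2 + Real.exp (2 * q) * ‖b‖ ^ 2 := by
      field_simp; rw [hs]; ring

theorem Lp_norm_rpow_eq_integral {Ω E : Type*} [MeasurableSpace Ω] {μ : Measure Ω}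
    [NormedAddCommGroup E] {p : ℝ}
    (hp : 0 < p) (f : Lp E (ENNReal.ofReal p) μ) :
    ‖f‖ ^ p = ∫ ω, ‖f ω‖ ^ p ∂μ := by
  have h0 : ENNReal.ofReal p ≠ 0 := by simpa using hp
  rw [Lp.norm_def, (Lp.memLp f).eLpNorm_eq_integral_rpow_norm h0 ENNReal.ofReal_ne_top,
    ENNReal.toReal_ofReal (by positivity), ENNReal.toReal_ofReal hp.le,
    Real.rpow_inv_rpow (by positivity) hp.ne']

theorem Lp_integrable_norm_rpow {Ω E : Type*} [MeasurableSpace Ω] {μ : Measure Ω}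
    [NormedAddCommGroup E] {p : ℝ}
    (hp : 0 < p) (f : Lp E (ENNReal.ofReal p) μ) :
    Integrable (fun ω => ‖f ω‖ ^ p) μ := by
  have h0 : ENNReal.ofReal p ≠ 0 := by simpa using hp
  have := (Lp.memLp f).integrable_norm_rpow h0 ENNReal.ofReal_ne_top
  rwa [ENNReal.toReal_ofReal hp.le] at this

theorem add_rpow_le_weighted {α β u v q : ℝ} (hα : 0 < α) (hβ : 0 < β) (hu : 0 ≤ u) (hv : 0 ≤ v)
    (hq : 1 ≤ q) :
    (u + v) ^ q ≤ (α + β) ^ (q - 1) * (α ^ (1 - q) * u ^ q + β ^ (1 - q) * v ^ q) := by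
  have hs : 0 < α + β := by positivity
  have h := (convexOn_rpow hq).2 (show u / α ∈ Set.Ici 0 from div_nonneg hu hα.le)
    (show v / β ∈ Set.Ici 0 from div_nonneg hv hβ.le) (div_nonneg hα.le hs.le)
    (div_nonneg hβ.le hs.le) (by field_simp)
  simp only [smul_eq_mul] at h
  have e : α / (α + β) * (u / α) + β / (α + β) * (v / β) = (u + v) / (α + β) := by
    field_simp
  rw [e, Real.div_rpow (by positivity) hs.le, Real.div_rpow hu hα.le, Real.div_rpow hv hβ.le,
    div_le_iff₀ (by positivity)] at h
  refine h.trans_eq ?_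
  rw [Real.rpow_sub hs, Real.rpow_sub hα, Real.rpow_sub hβ]
  simp only [Real.rpow_one]
  field_simp

theorem Lp_twoSmooth {Ω : Type*} [MeasurableSpace Ω] (μ : Measure Ω) {p : ℝ} (hp : 2 ≤ p)
    [Fact (1 ≤ ENNReal.ofReal p)] :
    TwoSmooth (Lp ℂ (ENNReal.ofReal p) μ) (Real.exp p) := by
  intro x y
  have hp0 : 0 < p := by linarith
  set K := Real.exp p with hK
  have hK1 : 1 ≤ K := Real.one_le_exp hp0.le
  rcases eq_or_ne x 0 with rfl | hx
  · simp only [zero_add, zero_sub, norm_neg, norm_zero]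
    nlinarith [sq_nonneg ‖y‖]
  rcases eq_or_ne y 0 with rfl | hy
  · simp [two_mul]
  have hx' := norm_pos_iff.2 hx
  have hy' := norm_pos_iff.2 hy
  obtain ⟨q, rfl⟩ : ∃ q, p = 2 * q := ⟨p / 2, by ring⟩
  have hq : 1 ≤ q := by linarith
  set α := ‖x‖ ^ 2 with hα
  set β := K * ‖y‖ ^ 2 with hβ
  have hα0 : 0 < α := by positivity
  have hβ0 : 0 < β := by positivity
  set c := (α + β) ^ (q - 1) with hc
  have hsq : ∀ z : ℝ, 0 ≤ z → (z ^ 2) ^ q = z ^ (2 * q) := fun z hz => by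
    rw [Real.rpow_mul hz, Real.rpow_two]
  have hpt : ∀ᵐ ω ∂μ, ‖(x + y) ω‖ ^ (2 * q) + ‖(x - y) ω‖ ^ (2 * q) ≤
      (2 * c * α ^ (1 - q)) * ‖x ω‖ ^ (2 * q) +
        (2 * c * β ^ (1 - q) * K ^ q) * ‖y ω‖ ^ (2 * q) := by
    filter_upwards [Lp.coeFn_add x y, Lp.coeFn_sub x y] with ω h1 h2
    rw [h1, h2]
    refine (norm_add_rpow_add_norm_sub_rpow_le (x ω) (y ω) hq).trans ?_
    have := add_rpow_le_weighted hα0 hβ0 (sq_nonneg ‖x ω‖)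
      (show 0 ≤ K * ‖y ω‖ ^ 2 by positivity) hq
    rw [Real.mul_rpow (y := ‖y ω‖ ^ 2) (by positivity) (by positivity), hsq _ (norm_nonneg _),
      hsq _ (norm_nonneg _)] at this
    linarith
  have hint := integral_mono_ae
    ((Lp_integrable_norm_rpow hp0 (x + y)).add (Lp_integrable_norm_rpow hp0 (x - y)))
    (((Lp_integrable_norm_rpow hp0 x).const_mul (2 * c * α ^ (1 - q))).add
      ((Lp_integrable_norm_rpow hp0 y).const_mul (2 * c * β ^ (1 - q) * K ^ q))) hpt
  simp only [Pi.add_apply] at hint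
  rw [integral_add (Lp_integrable_norm_rpow hp0 _) (Lp_integrable_norm_rpow hp0 _),
    integral_add ((Lp_integrable_norm_rpow hp0 _).const_mul _)
      ((Lp_integrable_norm_rpow hp0 _).const_mul _), integral_const_mul, integral_const_mul,
    ← Lp_norm_rpow_eq_integral hp0, ← Lp_norm_rpow_eq_integral hp0,
    ← Lp_norm_rpow_eq_integral hp0, ← Lp_norm_rpow_eq_integral hp0,
    ← hsq _ (norm_nonneg _), ← hsq _ (norm_nonneg _), ← hsq _ (norm_nonneg _),
    ← hsq _ (norm_nonneg _), ← hα] at hint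
  have e : 2 * c * α ^ (1 - q) * α ^ q + 2 * c * β ^ (1 - q) * K ^ q * (‖y‖ ^ 2) ^ q
      = 2 * (α + β) ^ q := by
    have e1 : K ^ q * (‖y‖ ^ 2) ^ q = β ^ q := by
      rw [← Real.mul_rpow (by positivity) (by positivity)]
    have e2 : ∀ z : ℝ, 0 < z → z ^ (1 - q) * z ^ q = z := fun z hz => by
      rw [← Real.rpow_add hz]; simp
    have e3 : c * (α + β) = (α + β) ^ q := by
      rw [hc, ← Real.rpow_add_one (by positivity)]; simp
    rw [mul_assoc (2 * c * β ^ (1 - q)), e1, mul_assoc (2 * c), mul_assoc (2 * c), e2 _ hα0,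
      e2 _ hβ0, ← mul_add, mul_assoc, e3]
  rw [e] at hint
  have hconv := (convexOn_rpow hq).2 (show ‖x + y‖ ^ 2 ∈ Set.Ici (0 : ℝ) from sq_nonneg ‖x + y‖)
    (show ‖x - y‖ ^ 2 ∈ Set.Ici (0 : ℝ) from sq_nonneg ‖x - y‖) (one_half_pos (α := ℝ)).le one_half_pos.le
    (by norm_num)
  simp only [smul_eq_mul] at hconv
  have : 1 / 2 * ‖x + y‖ ^ 2 + 1 / 2 * ‖x - y‖ ^ 2 ≤ α + β := by
    rw [← Real.rpow_le_rpow_iff (by positivity) (by positivity) (by linarith : 0 < q)]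
    linarith
  rw [hα, hβ] at this
  linarith

theorem TwoSmooth.four_point {X : Type*} [NormedAddCommGroup X] [NormedSpace ℂ X] {K : ℝ}
    (hK : 0 ≤ K) (hX : TwoSmooth X K) {x y z : X} {P : Fin 4 → X} {ε : ℝ}
    (h0 : ‖P 0 - (x + y + z)‖ ≤ ε) (h1 : ‖P 1 - (x + Complex.I • y - z)‖ ≤ ε)
    (h2 : ‖P 2 - (x - y + z)‖ ≤ ε) (h3 : ‖P 3 - (x - Complex.I • y - z)‖ ≤ ε) :
    ‖P 0‖ ^ 2 + ‖P 1‖ ^ 2 + ‖P 2‖ ^ 2 + ‖P 3‖ ^ 2 ≤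
      4 * (‖x‖ + ε) ^ 2 + 4 * K * (‖z‖ + ε) ^ 2 + 4 * K * (‖y‖ + ε) ^ 2 := by
  set E0 := P 0 - (x + y + z) with hE0
  set E1 := P 1 - (x + Complex.I • y - z) with hE1
  set E2 := P 2 - (x - y + z) with hE2
  set E3 := P 3 - (x - Complex.I • y - z) with hE3
  have p0 : P 0 = x + y + z + E0 := by rw [hE0]; abel
  have p1 : P 1 = x + Complex.I • y - z + E1 := by rw [hE1]; abel
  have p2 : P 2 = x - y + z + E2 := by rw [hE2]; abel
  have p3 : P 3 = x - Complex.I • y - z + E3 := by rw [hE3]; abel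
  have hhalf : ∀ a b : X, ‖a‖ ≤ ε → ‖b‖ ≤ ε → ‖(1 / 2 : ℂ) • (a + b)‖ ≤ ε := by
    intro a b ha hb
    rw [norm_smul]
    have := norm_add_le a b
    norm_num
    linarith
  have hhalf' : ∀ a b : X, ‖a‖ ≤ ε → ‖b‖ ≤ ε → ‖(1 / 2 : ℂ) • (a - b)‖ ≤ ε := by
    intro a b ha hb
    rw [sub_eq_add_neg]
    exact hhalf a (-b) ha (by rwa [norm_neg])
  set A := x + z + (1 / 2 : ℂ) • (E0 + E2) with hA
  set D := y + (1 / 2 : ℂ) • (E0 - E2) with hD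
  set A' := x - z + (1 / 2 : ℂ) • (E1 + E3) with hA'
  set D' := Complex.I • y + (1 / 2 : ℂ) • (E1 - E3) with hD'
  set c := x + (1 / 2 : ℂ) • ((1 / 2 : ℂ) • (E0 + E2) + (1 / 2 : ℂ) • (E1 + E3)) with hc
  set e := z + (1 / 2 : ℂ) • ((1 / 2 : ℂ) • (E0 + E2) - (1 / 2 : ℂ) • (E1 + E3)) with he
  have s1 := hX A D
  have s2 := hX A' D'
  have s3 := hX c e
  have q0 : A + D = P 0 := by rw [p0, hA, hD]; module
  have q2 : A - D = P 2 := by rw [p2, hA, hD]; module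
  have q1 : A' + D' = P 1 := by rw [p1, hA', hD']; module
  have q3 : A' - D' = P 3 := by rw [p3, hA', hD']; module
  have q4 : c + e = A := by rw [hA, hc, he]; module
  have q5 : c - e = A' := by rw [hA', hc, he]; module
  rw [q0, q2] at s1
  rw [q1, q3] at s2
  rw [q4, q5] at s3
  have n1 : ‖D‖ ≤ ‖y‖ + ε := (norm_add_le _ _).trans (by gcongr; exact hhalf' _ _ h0 h2)
  have n2 : ‖D'‖ ≤ ‖y‖ + ε := by
    refine (norm_add_le _ _).trans ?_
    rw [norm_smul, Complex.norm_I, one_mul]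
    gcongr; exact hhalf' _ _ h1 h3
  have n3 : ‖c‖ ≤ ‖x‖ + ε := (norm_add_le _ _).trans
    (by gcongr; exact hhalf _ _ (hhalf _ _ h0 h2) (hhalf _ _ h1 h3))
  have n4 : ‖e‖ ≤ ‖z‖ + ε := (norm_add_le _ _).trans
    (by gcongr; exact hhalf' _ _ (hhalf _ _ h0 h2) (hhalf _ _ h1 h3))
  have m1 : K * ‖D‖ ^ 2 ≤ K * (‖y‖ + ε) ^ 2 := by gcongr
  have m2 : K * ‖D'‖ ^ 2 ≤ K * (‖y‖ + ε) ^ 2 := by gcongr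
  have m3 : ‖c‖ ^ 2 ≤ (‖x‖ + ε) ^ 2 := by gcongr
  have m4 : K * ‖e‖ ^ 2 ≤ K * (‖z‖ + ε) ^ 2 := by gcongr
  linarith

/-- The coefficients grow subexponentially, so that `∑ z ^ j • b j` converges absolutely in the
unit disc. -/
def SubexpGrowth {X : Type*} [NormedAddCommGroup X] (b : ℕ → X) : Prop :=
  ∀ t : ℝ, t < 0 → Summable fun j : ℕ => Real.exp (j * t) * ‖b j‖

/-- The power series with coefficients `b`, in the coordinate `ζ = log z` on the left half
plane. -/
noncomputable def expSeries {X : Type*} [NormedAddCommGroup X] [NormedSpace ℂ X] (b : ℕ → X)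
    (ζ : ℂ) : X :=
  ∑' j : ℕ, Complex.exp (j * ζ) • b j

/-- The coefficients of the derivative of `expSeries b`. -/
def derivCoeff {X : Type*} [NormedAddCommGroup X] [NormedSpace ℂ X] (b : ℕ → X) (j : ℕ) : X :=
  (j : ℂ) • b j

section Series

variable {X : Type*} [NormedAddCommGroup X] [NormedSpace ℂ X]

theorem norm_exp_natCast_mul (j : ℕ) (ζ : ℂ) : ‖Complex.exp (j * ζ)‖ = Real.exp (j * ζ.re) := by
  rw [Complex.norm_exp]; simp

theorem SubexpGrowth.derivCoeff {b : ℕ → X} (hb : SubexpGrowth b) :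
    SubexpGrowth (derivCoeff b) := by
  intro t ht
  refine Summable.of_nonneg_of_le (fun j => by positivity) (fun j => ?_)
    ((hb (t / 2) (by linarith)).mul_left (2 / (-t)))
  rw [_root_.derivCoeff, norm_smul, Complex.norm_natCast]
  have h1 : (j : ℝ) * Real.exp (j * (t / 2)) ≤ 2 / (-t) := by
    have h2 := Real.add_one_le_exp (-(j * (t / 2)))
    rw [Real.exp_neg] at h2
    have h3 := Real.exp_pos (j * (t / 2))
    rw [le_div_iff₀ (by linarith)]
    have h4 := mul_le_mul_of_nonneg_right h2 h3.le
    rw [inv_mul_cancel₀ h3.ne'] at h4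
    nlinarith
  have h5 : Real.exp (j * t) = Real.exp (j * (t / 2)) * Real.exp (j * (t / 2)) := by
    rw [← Real.exp_add]; congr 1; ring
  rw [h5]
  calc _ = ((j : ℝ) * Real.exp (j * (t / 2))) * (Real.exp (j * (t / 2)) * ‖b j‖) := by ring
    _ ≤ _ := by gcongr

theorem norm_exp_smul_eq (b : ℕ → X) (j : ℕ) (ζ : ℂ) :
    ‖Complex.exp (j * ζ) • b j‖ = Real.exp (j * ζ.re) * ‖b j‖ := by
  rw [norm_smul, norm_exp_natCast_mul]

theorem SubexpGrowth.summable_norm {b : ℕ → X} (hb : SubexpGrowth b) {ζ : ℂ} (hζ : ζ.re < 0) :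
    Summable fun j : ℕ => ‖Complex.exp (j * ζ) • b j‖ := by
  simp_rw [norm_exp_smul_eq]; exact hb _ hζ

theorem SubexpGrowth.norm_expSeries_le {b : ℕ → X} (hb : SubexpGrowth b) {ζ : ℂ}
    (hζ : ζ.re < 0) : ‖expSeries b ζ‖ ≤ ∑' j : ℕ, Real.exp (j * ζ.re) * ‖b j‖ := by
  refine (norm_tsum_le_tsum_norm (hb.summable_norm hζ)).trans_eq ?_
  simp_rw [norm_exp_smul_eq]

theorem expSeries_periodic (b : ℕ → X) (t : ℝ) :
    Function.Periodic (fun θ : ℝ => expSeries b (t + θ * Complex.I)) (2 * Real.pi) := by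
  intro θ
  simp only [expSeries]
  congr 1; ext j
  congr 1
  have : (j : ℂ) * (t + ((θ + 2 * Real.pi : ℝ) : ℂ) * Complex.I) =
      j * (t + θ * Complex.I) + j * (2 * Real.pi * Complex.I) := by push_cast; ring
  rw [this, Complex.exp_add, Complex.exp_nat_mul_two_pi_mul_I, mul_one]

/-- The mean of `‖∑ z ^ j • b j‖ ^ 2` over the circle of radius `exp t`. -/
noncomputable def sqMean (b : ℕ → X) (t : ℝ) : ℝ :=
  (2 * Real.pi)⁻¹ * ∫ θ in (0 : ℝ)..2 * Real.pi, ‖expSeries b (t + θ * Complex.I)‖ ^ 2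

theorem sqMean_nonneg (b : ℕ → X) (t : ℝ) : 0 ≤ sqMean b t := by
  have := Real.pi_pos
  exact mul_nonneg (by positivity)
    (intervalIntegral.integral_nonneg (by positivity) fun _ _ => by positivity)

theorem integral_expSeries_shift (b : ℕ → X) (t s : ℝ) :
    ∫ θ in (0 : ℝ)..2 * Real.pi, ‖expSeries b (t + (θ + s : ℝ) * Complex.I)‖ ^ 2 =
      ∫ θ in (0 : ℝ)..2 * Real.pi, ‖expSeries b (t + θ * Complex.I)‖ ^ 2 := by
  have hper : Function.Periodic (fun θ : ℝ => ‖expSeries b (t + θ * Complex.I)‖ ^ 2)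
      (2 * Real.pi) := fun θ => by
    have := expSeries_periodic b t θ
    simp only at this ⊢
    rw [this]
  rw [intervalIntegral.integral_comp_add_right
    (fun θ : ℝ => ‖expSeries b (t + θ * Complex.I)‖ ^ 2)]
  have := hper.intervalIntegral_add_eq s 0
  rw [zero_add] at this
  rw [zero_add, add_comm (2 * Real.pi) s, this]

variable [CompleteSpace X]

theorem SubexpGrowth.hasSum {b : ℕ → X} (hb : SubexpGrowth b) {ζ : ℂ} (hζ : ζ.re < 0) :
    HasSum (fun j : ℕ => Complex.exp (j * ζ) • b j) (expSeries b ζ) :=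
  (hb.summable_norm hζ).of_norm.hasSum

theorem SubexpGrowth.continuousOn {b : ℕ → X} (hb : SubexpGrowth b) {t : ℝ} (ht : t < 0) :
    ContinuousOn (expSeries b) {ζ | ζ.re ≤ t} := by
  refine continuousOn_tsum (fun j => by fun_prop) (hb t ht) fun j ζ hζ => ?_
  rw [norm_exp_smul_eq]
  have : ζ.re ≤ t := hζ
  gcongr

theorem SubexpGrowth.continuous_slice {b : ℕ → X} (hb : SubexpGrowth b) {t : ℝ} (ht : t < 0) :
    Continuous fun θ : ℝ => expSeries b (t + θ * Complex.I) :=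
  (hb.continuousOn ht).comp_continuous (by fun_prop) fun θ => by simp

theorem SubexpGrowth.norm_taylor_le {b : ℕ → X} (hb : SubexpGrowth b) {ζ w : ℂ}
    (hζ : ζ.re < 0) (hw : ‖w‖ ≤ -ζ.re / 2) :
    ‖expSeries b (ζ + w) - (expSeries b ζ + w • expSeries (_root_.derivCoeff b) ζ +
      (w ^ 2 / 2) • expSeries (_root_.derivCoeff (_root_.derivCoeff b)) ζ)‖ ≤
      ‖w‖ ^ 3 * ∑' j : ℕ, Real.exp (j * (ζ.re / 2)) *
        ‖_root_.derivCoeff (_root_.derivCoeff (_root_.derivCoeff b)) j‖ := by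
  have hwre : w.re ≤ -ζ.re / 2 := (Complex.re_le_norm w).trans hw
  have hζw : (ζ + w).re < 0 := by rw [Complex.add_re]; linarith
  have hsum := (hb.hasSum hζw).sub (((hb.hasSum hζ).add
    ((hb.derivCoeff.hasSum hζ).const_smul w)).add
      ((hb.derivCoeff.derivCoeff.hasSum hζ).const_smul (w ^ 2 / 2)))
  rw [← hsum.tsum_eq, ← tsum_mul_left]
  refine tsum_of_norm_bounded
    ((hb.derivCoeff.derivCoeff.derivCoeff (ζ.re / 2) (by linarith)).mul_left _).hasSum
    fun j => ?_
  have e : Complex.exp (j * (ζ + w)) • b j - (Complex.exp (j * ζ) • b j +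
      w • Complex.exp (j * ζ) • _root_.derivCoeff b j +
      (w ^ 2 / 2) • Complex.exp (j * ζ) • _root_.derivCoeff (_root_.derivCoeff b) j) =
      (Complex.exp (j * ζ) * (Complex.exp (j * w) -
        ∑ m ∈ range 3, (j * w) ^ m / m.factorial)) • b j := by
    simp only [_root_.derivCoeff, mul_add, Complex.exp_add, Finset.sum_range_succ,
      Finset.sum_range_zero, Nat.factorial]
    push_cast
    module
  rw [e, norm_smul, norm_mul, norm_exp_natCast_mul]
  simp only [_root_.derivCoeff, norm_smul, Complex.norm_natCast]
  have h1 := Complex.norm_exp_sub_sum_le_norm_mul_exp (j * w) 3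
  rw [norm_mul, Complex.norm_natCast] at h1
  have h2 : Real.exp (j * ζ.re) * Real.exp (j * ‖w‖) ≤ Real.exp (j * (ζ.re / 2)) := by
    rw [← Real.exp_add, Real.exp_le_exp, ← mul_add]
    gcongr; linarith
  calc _ ≤ Real.exp (j * ζ.re) * ((j * ‖w‖) ^ 3 * Real.exp (j * ‖w‖)) * ‖b j‖ := by gcongr
    _ = (j * ‖w‖) ^ 3 * (Real.exp (j * ζ.re) * Real.exp (j * ‖w‖)) * ‖b j‖ := by ring
    _ ≤ (j * ‖w‖) ^ 3 * Real.exp (j * (ζ.re / 2)) * ‖b j‖ := by gcongr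
    _ = _ := by ring

theorem SubexpGrowth.sqMean_le {b : ℕ → X} (hb : SubexpGrowth b) {t B : ℝ} (ht : t < 0)
    (hB : ∀ θ : ℝ, ‖expSeries b (t + θ * Complex.I)‖ ^ 2 ≤ B) : sqMean b t ≤ B := by
  have hpi := Real.pi_pos
  have h := intervalIntegral.integral_mono_on (μ := volume) (a := 0) (b := 2 * Real.pi)
    (by positivity) (((hb.continuous_slice ht).norm.pow 2).intervalIntegrable _ _)
    (continuous_const.intervalIntegrable _ _) (fun θ _ => hB θ)
  rw [intervalIntegral.integral_const, smul_eq_mul, sub_zero] at h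
  rw [sqMean, inv_mul_le_iff₀ (by positivity)]
  exact h

theorem SubexpGrowth.continuousOn_sqMean {b : ℕ → X} (hb : SubexpGrowth b) {t₀ : ℝ}
    (ht₀ : t₀ < 0) : ContinuousOn (sqMean b) (Set.Iic t₀) := by
  have h1 : Continuous fun t : ℝ => (2 * Real.pi)⁻¹ * ∫ θ in (0 : ℝ)..2 * Real.pi,
      ‖expSeries b ((min t t₀ : ℝ) + θ * Complex.I)‖ ^ 2 := by
    refine continuous_const.mul
      (intervalIntegral.continuous_parametric_intervalIntegral_of_continuous' ?_ _ _)
    refine Continuous.pow (Continuous.norm ?_) 2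
    exact (hb.continuousOn ht₀).comp_continuous (by fun_prop) fun x => by simp
  refine h1.continuousOn.congr fun t ht => ?_
  have hmin : min t t₀ = t := min_eq_left ht
  simp only [sqMean, hmin]

theorem SubexpGrowth.sqMean_second_diff_le {b : ℕ → X} (hb : SubexpGrowth b) {K : ℝ}
    (hK : 0 ≤ K) (hX : TwoSmooth X K) {t B : ℝ} (ht : t < 0)
    (hB : ∀ θ : ℝ, ‖expSeries (_root_.derivCoeff b) (t + θ * Complex.I)‖ ≤ B) :
    ∃ M : ℝ, ∀ h : ℝ, 0 < h → h ≤ 1 → h ≤ -t / 2 →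
      sqMean b (t + h) + sqMean b (t - h) - 2 * sqMean b t ≤ 4 * K * B ^ 2 * h ^ 2 + M * h ^ 3 := by
  set S₀ := ∑' j : ℕ, Real.exp (j * t) * ‖b j‖ with hS₀
  set S₂ := ∑' j : ℕ, Real.exp (j * t) * ‖_root_.derivCoeff (_root_.derivCoeff b) j‖ with hS₂
  set S := ∑' j : ℕ, Real.exp (j * (t / 2)) *
    ‖_root_.derivCoeff (_root_.derivCoeff (_root_.derivCoeff b)) j‖ with hS
  have hS₀0 : 0 ≤ S₀ := tsum_nonneg fun j => by positivity
  have hS₂0 : 0 ≤ S₂ := tsum_nonneg fun j => by positivity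
  have hS0 : 0 ≤ S := tsum_nonneg fun j => by positivity
  have hB0 : 0 ≤ B := (norm_nonneg _).trans (hB 0)
  set M := 8 * S₀ * S + 4 * S ^ 2 + 4 * K * (S₂ + S) ^ 2 + 8 * K * B * S + 4 * K * S ^ 2 with hM
  refine ⟨M, fun h hh0 hh1 hht => ?_⟩
  have hpt : ∀ θ : ℝ,
      ‖expSeries b ((t + h : ℝ) + θ * Complex.I)‖ ^ 2 +
      ‖expSeries b (t + (θ + h : ℝ) * Complex.I)‖ ^ 2 +
      ‖expSeries b ((t - h : ℝ) + θ * Complex.I)‖ ^ 2 +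
      ‖expSeries b (t + (θ + -h : ℝ) * Complex.I)‖ ^ 2 ≤
      4 * ‖expSeries b (t + θ * Complex.I)‖ ^ 2 + (4 * K * B ^ 2 * h ^ 2 + M * h ^ 3) := by
    intro θ
    set ζ : ℂ := t + θ * Complex.I with hζ
    have hre : ζ.re = t := by simp [hζ]
    have hζ0 : ζ.re < 0 := by rw [hre]; exact ht
    set g := expSeries b ζ with hg
    set g₁ := expSeries (_root_.derivCoeff b) ζ with hg₁
    set g₂ := expSeries (_root_.derivCoeff (_root_.derivCoeff b)) ζ with hg₂
    have htay : ∀ w : ℂ, ‖w‖ = h →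
        ‖expSeries b (ζ + w) - (g + w • g₁ + (w ^ 2 / 2) • g₂)‖ ≤ h ^ 3 * S := by
      intro w hw
      have := hb.norm_taylor_le hζ0 (w := w) (by rw [hre, hw]; exact hht)
      rwa [hre, hw] at this
    have hn : ‖(h : ℂ)‖ = h := by rw [Complex.norm_real, Real.norm_of_nonneg hh0.le]
    have key := hX.four_point hK (x := g) (y := (h : ℂ) • g₁) (z := ((h : ℂ) ^ 2 / 2) • g₂)
      (P := ![expSeries b (ζ + h), expSeries b (ζ + Complex.I * h), expSeries b (ζ + -h),
        expSeries b (ζ + -(Complex.I * h))]) (ε := h ^ 3 * S)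
      (htay h hn)
      (by
        convert htay (Complex.I * h) (by simp [hh0.le]) using 2
        simp only [mul_pow, Complex.I_sq]
        change expSeries b (ζ + Complex.I * h) - _ = _
        module)
      (by
        convert htay (-h) (by simp [hh0.le]) using 2
        change expSeries b (ζ + -h) - _ = _
        module)
      (by
        convert htay (-(Complex.I * h)) (by simp [hh0.le]) using 2
        simp only [neg_sq, mul_pow, Complex.I_sq]
        change expSeries b (ζ + -(Complex.I * h)) - _ = _
        module)
    have a0 : ((t + h : ℝ) : ℂ) + θ * Complex.I = ζ + h := by rw [hζ]; push_cast; ring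
    have a1 : (t : ℂ) + (θ + h : ℝ) * Complex.I = ζ + Complex.I * h := by
      rw [hζ]; push_cast; ring
    have a2 : ((t - h : ℝ) : ℂ) + θ * Complex.I = ζ + -h := by rw [hζ]; push_cast; ring
    have a3 : (t : ℂ) + (θ + -h : ℝ) * Complex.I = ζ + -(Complex.I * h) := by
      rw [hζ]; push_cast; ring
    rw [a0, a1, a2, a3]
    refine key.trans ?_
    have ng : ‖g‖ ≤ S₀ := by
      have := hb.norm_expSeries_le hζ0; rwa [hre] at this
    have ng₂ : ‖((h : ℂ) ^ 2 / 2) • g₂‖ ≤ h ^ 2 * S₂ := by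
      have := hb.derivCoeff.derivCoeff.norm_expSeries_le hζ0
      rw [hre] at this
      rw [norm_smul, norm_div, norm_pow, hn]
      have h2 : h ^ 2 / ‖(2 : ℂ)‖ ≤ h ^ 2 := by
        rw [Complex.norm_ofNat]; nlinarith [sq_nonneg h]
      gcongr
    have ng₁ : ‖(h : ℂ) • g₁‖ ≤ h * B := by
      rw [norm_smul, hn]; gcongr; exact hB θ
    have hpow : ∀ n : ℕ, h ^ (3 + n) ≤ h ^ 3 := fun n =>
      pow_le_pow_of_le_one hh0.le hh1 (by omega)
    have b1 : 4 * (‖g‖ + h ^ 3 * S) ^ 2 ≤ 4 * ‖g‖ ^ 2 + (8 * S₀ * S + 4 * S ^ 2) * h ^ 3 := by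
      have c1 : ‖g‖ * (h ^ 3 * S) ≤ S₀ * (h ^ 3 * S) := by gcongr
      have c2 : h ^ (3 + 3) * S ^ 2 ≤ h ^ 3 * S ^ 2 :=
        mul_le_mul_of_nonneg_right (hpow 3) (sq_nonneg S)
      have c3 : (‖g‖ + h ^ 3 * S) ^ 2 =
        ‖g‖ ^ 2 + 2 * (‖g‖ * (h ^ 3 * S)) + h ^ (3 + 3) * S ^ 2 := by ring
      rw [c3]; linarith
    have b2 : 4 * K * (‖((h : ℂ) ^ 2 / 2) • g₂‖ + h ^ 3 * S) ^ 2 ≤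
        (4 * K * (S₂ + S) ^ 2) * h ^ 3 := by
      have c1 : ‖((h : ℂ) ^ 2 / 2) • g₂‖ + h ^ 3 * S ≤ h ^ 2 * (S₂ + S) := by
        have : h ^ 3 * S ≤ h ^ 2 * S := by
          gcongr ?_ * S; exact pow_le_pow_of_le_one hh0.le hh1 (by omega)
        linarith
      calc _ ≤ 4 * K * (h ^ 2 * (S₂ + S)) ^ 2 := by gcongr
        _ = 4 * K * (S₂ + S) ^ 2 * h ^ (3 + 1) := by ring
        _ ≤ _ := mul_le_mul_of_nonneg_left (hpow 1) (by positivity)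
    have b3 : 4 * K * (‖(h : ℂ) • g₁‖ + h ^ 3 * S) ^ 2 ≤
        4 * K * B ^ 2 * h ^ 2 + (8 * K * B * S + 4 * K * S ^ 2) * h ^ 3 := by
      calc _ ≤ 4 * K * (h * B + h ^ 3 * S) ^ 2 := by gcongr
        _ = 4 * K * B ^ 2 * h ^ 2 + 8 * K * B * S * h ^ (3 + 1) +
            4 * K * S ^ 2 * h ^ (3 + 3) := by ring
        _ ≤ 4 * K * B ^ 2 * h ^ 2 + 8 * K * B * S * h ^ 3 + 4 * K * S ^ 2 * h ^ 3 := by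
          have d1 := mul_le_mul_of_nonneg_left (hpow 1) (show 0 ≤ 8 * K * B * S by positivity)
          have d2 := mul_le_mul_of_nonneg_left (hpow 3) (show 0 ≤ 4 * K * S ^ 2 by positivity)
          linarith
        _ = _ := by ring
    rw [hM]
    linarith
  have hpi := Real.pi_pos
  have hcont : ∀ s : ℝ, s < 0 → ∀ r : ℝ, IntervalIntegrable
      (fun θ : ℝ => ‖expSeries b (s + (θ + r : ℝ) * Complex.I)‖ ^ 2) volume 0 (2 * Real.pi) :=
    fun s hs r => ((((hb.continuous_slice hs).comp
      (continuous_add_const r)).norm.pow 2).intervalIntegrable _ _)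
  have hcont' : ∀ s : ℝ, s < 0 → IntervalIntegrable
      (fun θ : ℝ => ‖expSeries b (s + θ * Complex.I)‖ ^ 2) volume 0 (2 * Real.pi) :=
    fun s hs => (((hb.continuous_slice hs).norm.pow 2).intervalIntegrable _ _)
  have i1 := hcont' (t + h) (by linarith)
  have i2 := hcont t ht h
  have i3 := hcont' (t - h) (by linarith)
  have i4 := hcont t ht (-h)
  have i5 := hcont' t ht
  have hmono := intervalIntegral.integral_mono_on (μ := volume) (a := 0) (b := 2 * Real.pi)
    (by positivity) (((i1.add i2).add i3).add i4)
    ((i5.const_mul 4).add (continuous_const.intervalIntegrable _ _)) (fun θ _ => hpt θ)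
  rw [intervalIntegral.integral_add ((i1.add i2).add i3) i4,
    intervalIntegral.integral_add (i1.add i2) i3, intervalIntegral.integral_add i1 i2,
    intervalIntegral.integral_add (i5.const_mul 4) (continuous_const.intervalIntegrable _ _),
    intervalIntegral.integral_const_mul, intervalIntegral.integral_const,
    integral_expSeries_shift, integral_expSeries_shift, smul_eq_mul, sub_zero] at hmono
  simp only [sqMean]
  have hmul := mul_le_mul_of_nonneg_left hmono (show 0 ≤ (2 * Real.pi)⁻¹ by positivity)
  rw [mul_add _ (4 * _), ← mul_assoc _ (2 * Real.pi), inv_mul_cancel₀ (by positivity),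
    one_mul] at hmul
  linarith

end Series

/-- A normed space is 2-uniformly convex with constant `c`. -/
def TwoConvex (X : Type*) [NormedAddCommGroup X] (c : ℝ) : Prop :=
  ∀ x y : X, 2 * ‖x‖ ^ 2 + 2 * c * ‖y‖ ^ 2 ≤ ‖x + y‖ ^ 2 + ‖x - y‖ ^ 2

/-- A space normed by a 2-uniformly smooth space is 2-uniformly convex. -/
theorem TwoSmooth.twoConvex_of_norming {X Y : Type*} [NormedAddCommGroup X] [NormedSpace ℂ X]
    [NormedAddCommGroup Y] [NormedSpace ℂ Y] {K : ℝ} (hK : 0 < K) (hY : TwoSmooth Y K)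
    (B : X →L[ℂ] Y →L[ℂ] ℂ) (hB : ∀ x y, ‖B x y‖ ≤ ‖x‖ * ‖y‖)
    (hn : ∀ x, ∃ y, ‖y‖ = ‖x‖ ∧ B x y = (‖x‖ ^ 2 : ℝ)) :
    TwoConvex X K⁻¹ := by
  intro f g
  obtain ⟨h, hh, hf⟩ := hn f
  obtain ⟨k₀, hk₀, hg⟩ := hn g
  set k : Y := ((K⁻¹ : ℝ) : ℂ) • k₀ with hk
  set A := ‖f‖ ^ 2 + K⁻¹ * ‖g‖ ^ 2 with hA
  set S := ‖f + g‖ ^ 2 + ‖f - g‖ ^ 2 with hS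
  have hkn : ‖k‖ = K⁻¹ * ‖g‖ := by
    rw [hk, norm_smul, Complex.norm_real, Real.norm_of_nonneg (by positivity), hk₀]
  have e1 : B f h + B g k = (A : ℝ) := by
    rw [hf, hk, map_smul, hg, hA, smul_eq_mul]; push_cast; ring
  have e2 : B (f + g) (h + k) + B (f - g) (h - k) = 2 * (B f h + B g k) := by
    simp only [map_add, map_sub, add_apply, sub_apply]
    ring
  have hA0 : 0 ≤ A := by positivity
  have h2A : 2 * A ≤ ‖f + g‖ * ‖h + k‖ + ‖f - g‖ * ‖h - k‖ := by
    have h3 : ‖B (f + g) (h + k) + B (f - g) (h - k)‖ = 2 * A := by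
      rw [e2, e1, norm_mul, Complex.norm_real, Real.norm_of_nonneg hA0]; simp
    rw [← h3]
    exact (norm_add_le _ _).trans (add_le_add (hB _ _) (hB _ _))
  have hsm := hY h k
  have hR : 2 * ‖h‖ ^ 2 + 2 * K * ‖k‖ ^ 2 = 2 * A := by
    rw [hh, hkn, hA]; field_simp
  rw [hR] at hsm
  have hcs : (2 * A) ^ 2 ≤ S * (2 * A) := by
    calc (2 * A) ^ 2 ≤ (‖f + g‖ * ‖h + k‖ + ‖f - g‖ * ‖h - k‖) ^ 2 := by gcongr
      _ ≤ S * (‖h + k‖ ^ 2 + ‖h - k‖ ^ 2) := by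
        rw [hS]; nlinarith [sq_nonneg (‖f + g‖ * ‖h - k‖ - ‖f - g‖ * ‖h + k‖)]
      _ ≤ S * (2 * A) := by gcongr
  have hS0 : 0 ≤ S := by positivity
  have : 2 * A ≤ S := by
    rcases hA0.eq_or_lt with h | h
    · rw [← h]; simpa using hS0
    · nlinarith
  rw [hA] at this
  linarith

theorem StrongDual.exists_re_apply_ge {X : Type*} [NormedAddCommGroup X] [NormedSpace ℂ X]
    (f : StrongDual ℂ X) {δ : ℝ} (hδ : 0 < δ) :
    ∃ u : X, ‖u‖ ≤ ‖f‖ ∧ ‖f‖ ^ 2 - δ * ‖f‖ ≤ (f u).re := by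
  obtain ⟨x, hx, hfx⟩ := f.exists_lt_apply_of_lt_opNorm (sub_lt_self ‖f‖ hδ)
  obtain ⟨w, hw, hwf⟩ : ∃ w : ℂ, ‖w‖ = 1 ∧ w * f x = ‖f x‖ := by
    rcases eq_or_ne (f x) 0 with h | h
    · exact ⟨1, by simp, by simp [h]⟩
    · refine ⟨‖f x‖ / f x, by simp [h], by field_simp⟩
  refine ⟨((‖f‖ : ℂ) * w) • x, ?_, ?_⟩
  · rw [norm_smul, norm_mul, hw]
    simpa using mul_le_of_le_one_right (norm_nonneg f) hx.le
  · rw [map_smul, smul_eq_mul, mul_assoc, hwf, ← Complex.ofReal_mul, Complex.ofReal_re]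
    nlinarith [norm_nonneg f]

theorem TwoConvex.twoSmooth_dual {X : Type*} [NormedAddCommGroup X] [NormedSpace ℂ X] {c : ℝ}
    (hc : 0 < c) (hX : TwoConvex X c) : TwoSmooth (StrongDual ℂ X) c⁻¹ := by
  intro f g
  set S := ‖f + g‖ ^ 2 + ‖f - g‖ ^ 2 with hS
  set R := 2 * ‖f‖ ^ 2 + 2 * c⁻¹ * ‖g‖ ^ 2 with hR
  have hR0 : 0 ≤ R := by positivity
  have hS0 : 0 ≤ S := by positivity
  have hmain : S ≤ √(R * S) := by
    have hstep : ∀ δ > 0, S - δ * (‖f + g‖ + ‖f - g‖) ≤ √(R * S) := by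
      intro δ hδ
      obtain ⟨u, hu, hfu⟩ := StrongDual.exists_re_apply_ge (f + g) hδ
      obtain ⟨v, hv, hfv⟩ := StrongDual.exists_re_apply_ge (f - g) hδ
      have hre : ((f + g) u).re + ((f - g) v).re ≤ ‖f‖ * ‖u + v‖ + ‖g‖ * ‖u - v‖ := by
        have : (f + g) u + (f - g) v = f (u + v) + g (u - v) := by
          simp only [map_add, map_sub, add_apply,
            sub_apply]
          ring
        rw [← Complex.add_re, this]
        exact (Complex.re_le_norm _).trans ((norm_add_le _ _).trans
          (add_le_add (f.le_opNorm _) (g.le_opNorm _)))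
      have hcv := hX (u + v) (u - v)
      have e1 : u + v + (u - v) = (2 : ℂ) • u := by rw [two_smul]; abel
      have e2 : u + v - (u - v) = (2 : ℂ) • v := by rw [two_smul]; abel
      rw [e1, e2, norm_smul, norm_smul] at hcv
      simp only [Complex.norm_ofNat] at hcv
      have hcv' : ‖u + v‖ ^ 2 + c * ‖u - v‖ ^ 2 ≤ 2 * S := by
        have h1 : ‖u‖ ^ 2 ≤ ‖f + g‖ ^ 2 := by gcongr
        have h2 : ‖v‖ ^ 2 ≤ ‖f - g‖ ^ 2 := by gcongr
        rw [hS]; nlinarith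
      have hb : ‖f‖ * ‖u + v‖ + ‖g‖ * ‖u - v‖ ≤ √(R * S) := by
        apply Real.le_sqrt_of_sq_le
        have hcs : (‖f‖ * ‖u + v‖ + ‖g‖ * ‖u - v‖) ^ 2 ≤
            (‖f‖ ^ 2 + c⁻¹ * ‖g‖ ^ 2) * (‖u + v‖ ^ 2 + c * ‖u - v‖ ^ 2) := by
          have hpos : 0 ≤ c⁻¹ * (c * ‖f‖ * ‖u - v‖ - ‖g‖ * ‖u + v‖) ^ 2 := by positivity
          have heq : (‖f‖ ^ 2 + c⁻¹ * ‖g‖ ^ 2) * (‖u + v‖ ^ 2 + c * ‖u - v‖ ^ 2) -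
              (‖f‖ * ‖u + v‖ + ‖g‖ * ‖u - v‖) ^ 2 =
              c⁻¹ * (c * ‖f‖ * ‖u - v‖ - ‖g‖ * ‖u + v‖) ^ 2 := by
            field_simp; ring
          linarith
        calc _ ≤ _ := hcs
          _ ≤ (‖f‖ ^ 2 + c⁻¹ * ‖g‖ ^ 2) * (2 * S) := by gcongr
          _ = R * S := by rw [hR]; ring
      rw [hS] at *
      linarith
    refine le_of_forall_pos_le_add fun ε hε => ?_
    have hd : 0 < ‖f + g‖ + ‖f - g‖ + 1 := by positivity
    have h1 := hstep (ε / (‖f + g‖ + ‖f - g‖ + 1)) (by positivity)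
    have h2 : ε / (‖f + g‖ + ‖f - g‖ + 1) * (‖f + g‖ + ‖f - g‖) ≤ ε := by
      rw [div_mul_eq_mul_div, div_le_iff₀ hd]; nlinarith
    linarith
  have hsq : S ^ 2 ≤ R * S := by
    calc S ^ 2 ≤ √(R * S) ^ 2 := by gcongr
      _ = R * S := Real.sq_sqrt (by positivity)
  rcases hS0.eq_or_lt with h | h
  · rw [← h]; exact hR0
  · nlinarith

/-- The Banach space adjoint of a bounded operator. -/
noncomputable def dualOp {X : Type*} [NormedAddCommGroup X] [NormedSpace ℂ X] (T : X →L[ℂ] X) :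
    StrongDual ℂ X →L[ℂ] StrongDual ℂ X :=
  (ContinuousLinearMap.compL ℂ X X ℂ).flip T

section dualOp

set_option synthInstance.maxHeartbeats 200000

variable {X : Type*} [NormedAddCommGroup X] [NormedSpace ℂ X]

@[simp] theorem dualOp_apply (T : X →L[ℂ] X) (f : StrongDual ℂ X) (x : X) :
    dualOp T f x = f (T x) := rfl

theorem dualOp_one : dualOp (1 : X →L[ℂ] X) = 1 := rfl

theorem dualOp_mul (S T : X →L[ℂ] X) : dualOp (S * T) = dualOp T * dualOp S := rfl

theorem dualOp_smul_one_sub (a : ℂ) (T : X →L[ℂ] X) :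
    dualOp (a • 1 - T) = a • 1 - dualOp T := by
  ext f x; simp

theorem dualOp_pow (T : X →L[ℂ] X) (n : ℕ) : dualOp (T ^ n) = dualOp T ^ n := by
  induction n with
  | zero => exact dualOp_one
  | succ n ih => rw [pow_succ, dualOp_mul, ih, pow_succ']

theorem norm_dualOp_le (T : X →L[ℂ] X) : ‖dualOp T‖ ≤ ‖T‖ := by
  refine ContinuousLinearMap.opNorm_le_bound _ (norm_nonneg _) fun f => ?_
  rw [mul_comm]
  exact ContinuousLinearMap.opNorm_comp_le f T

theorem norm_le_norm_dualOp (T : X →L[ℂ] X) : ‖T‖ ≤ ‖dualOp T‖ := by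
  refine ContinuousLinearMap.opNorm_le_bound _ (ContinuousLinearMap.opNorm_nonneg _) fun x => ?_
  refine NormedSpace.norm_le_dual_bound ℂ (T x)
    (mul_nonneg (ContinuousLinearMap.opNorm_nonneg _) (norm_nonneg x)) fun f => ?_
  calc ‖f (T x)‖ = ‖dualOp T f x‖ := rfl
    _ ≤ ‖dualOp T f‖ * ‖x‖ := (dualOp T f).le_opNorm x
    _ ≤ ‖dualOp T‖ * ‖f‖ * ‖x‖ := by gcongr; exact (dualOp T).le_opNorm f
    _ = _ := by ring

end dualOp

set_option synthInstance.maxHeartbeats 200000 in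
theorem KreissBounded.dualOp {X : Type} [NormedAddCommGroup X] [NormedSpace ℂ X]
    {T : X →L[ℂ] X} (hT : KreissBounded T) : KreissBounded (dualOp T) := by
  obtain ⟨C, hC, h⟩ := hT
  refine ⟨C, hC, fun lam hlam => ?_⟩
  obtain ⟨⟨u, hu⟩, hb⟩ := h lam hlam
  rw [← hu, Ring.inverse_unit] at hb
  let v : (StrongDual ℂ X →L[ℂ] StrongDual ℂ X)ˣ :=
    ⟨_root_.dualOp u, _root_.dualOp ↑u⁻¹, by rw [← dualOp_mul, u.inv_mul, dualOp_one],
      by rw [← dualOp_mul, u.mul_inv, dualOp_one]⟩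
  have hv : (v : StrongDual ℂ X →L[ℂ] StrongDual ℂ X) = lam • 1 - _root_.dualOp T := by
    rw [← dualOp_smul_one_sub, ← hu]
  rw [← hv, Ring.inverse_unit]
  exact ⟨v.isUnit, (norm_dualOp_le _).trans hb⟩

theorem norm_lpPairing_mul_le {Ω : Type*} [MeasurableSpace Ω] (μ : Measure Ω)
    {p q : ENNReal} [Fact (1 ≤ p)] [Fact (1 ≤ q)] [p.HolderConjugate q]
    (f : Lp ℂ p μ) (g : Lp ℂ q μ) :
    ‖(ContinuousLinearMap.mul ℂ ℂ).lpPairing μ p q f g‖ ≤ ‖f‖ * ‖g‖ := by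
  have h1 : ‖(ContinuousLinearMap.mul ℂ ℂ).lpPairing μ p q f g‖ ≤
      ‖(ContinuousLinearMap.mul ℂ ℂ).holder 1 f g‖ := by
    rw [ContinuousLinearMap.lpPairing_eq_integral,
      ← integral_congr_ae (ContinuousLinearMap.coeFn_holder (r := 1) _ _ _),
      ← L1.integral_eq_integral]
    exact L1.norm_integral_le _
  have h2 := (ContinuousLinearMap.mul ℂ ℂ).norm_holder_apply_apply_le (r := 1) f g
  simpa using h1.trans h2

theorem exists_norming_Lp {Ω : Type*} [MeasurableSpace Ω] (μ : Measure Ω)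
    {p q : ℝ} (hpq : p.HolderConjugate q) [Fact (1 ≤ ENNReal.ofReal p)]
    [Fact (1 ≤ ENNReal.ofReal q)] [(ENNReal.ofReal p).HolderConjugate (ENNReal.ofReal q)]
    (f : Lp ℂ (ENNReal.ofReal p) μ) :
    ∃ h : Lp ℂ (ENNReal.ofReal q) μ, ‖h‖ = ‖f‖ ∧
      (ContinuousLinearMap.mul ℂ ℂ).lpPairing μ (ENNReal.ofReal p) (ENNReal.ofReal q) f h =
        (‖f‖ ^ 2 : ℝ) := by
  rcases eq_or_ne f 0 with rfl | hf
  · exact ⟨0, by simp, by simp⟩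
  have hf0 := norm_pos_iff.2 hf
  have hp0 := hpq.pos
  have hq0 := hpq.symm.pos
  have hq0' : ENNReal.ofReal q ≠ 0 := by simpa using hq0
  have hpq1 : (p - 1) * q = p := hpq.sub_one_mul_conj
  set φ : Ω → ℂ := fun ω => ((‖f‖ ^ (2 - p) : ℝ) : ℂ) *
    ((starRingEnd ℂ) (f ω) * ((‖f ω‖ ^ (p - 2) : ℝ) : ℂ)) with hφ
  have hφn : ∀ ω, ‖φ ω‖ ^ q = ‖f‖ ^ ((2 - p) * q) * ‖f ω‖ ^ p := by
    intro ω
    have h1 : ‖f ω‖ * ‖f ω‖ ^ (p - 2) = ‖f ω‖ ^ (p - 1) := by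
      rcases eq_or_ne (f ω) 0 with h | h
      · simp [h, Real.zero_rpow hpq.sub_one_ne_zero]
      · rw [mul_comm, ← Real.rpow_add_one (norm_ne_zero_iff.2 h)]; congr 1; ring
    rw [hφ]
    simp only [norm_mul, Complex.norm_real, RCLike.norm_conj]
    rw [Real.norm_of_nonneg (by positivity), Real.norm_of_nonneg (by positivity), h1,
      Real.mul_rpow (by positivity) (by positivity), ← Real.rpow_mul (by positivity),
      ← Real.rpow_mul (by positivity), hpq1]
  have hfm : AEStronglyMeasurable (f : Ω → ℂ) μ := Lp.aestronglyMeasurable f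
  have hφm : AEStronglyMeasurable φ μ := by
    have h1 : AEMeasurable (f : Ω → ℂ) μ := hfm.aemeasurable
    apply AEMeasurable.aestronglyMeasurable
    refine AEMeasurable.const_mul (AEMeasurable.mul ?_ ?_) _
    · exact Complex.continuous_conj.measurable.comp_aemeasurable h1
    · exact Complex.measurable_ofReal.comp_aemeasurable (h1.norm.pow_const _)
  have hφL : MemLp φ (ENNReal.ofReal q) μ := by
    rw [← integrable_norm_rpow_iff hφm hq0' ENNReal.ofReal_ne_top,
      ENNReal.toReal_ofReal hq0.le]
    simp_rw [hφn]
    exact (Lp_integrable_norm_rpow hp0 f).const_mul _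
  have hae := hφL.coeFn_toLp
  refine ⟨hφL.toLp φ, ?_, ?_⟩
  · have h1 : ‖hφL.toLp φ‖ ^ q = ‖f‖ ^ q := by
      rw [Lp_norm_rpow_eq_integral hq0]
      have : ∫ ω, ‖hφL.toLp φ ω‖ ^ q ∂μ = ∫ ω, ‖f‖ ^ ((2 - p) * q) * ‖f ω‖ ^ p ∂μ := by
        refine integral_congr_ae ?_
        filter_upwards [hae] with ω hω
        rw [hω, hφn]
      rw [this, integral_const_mul, ← Lp_norm_rpow_eq_integral hp0, ← Real.rpow_add hf0]
      congr 1
      linear_combination -hpq1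
    exact (Real.rpow_left_inj (norm_nonneg _) (norm_nonneg _) hq0.ne').1 h1
  · rw [ContinuousLinearMap.lpPairing_eq_integral]
    have : ∫ ω, ContinuousLinearMap.mul ℂ ℂ (f ω) (hφL.toLp φ ω) ∂μ =
        ∫ ω, ((‖f‖ ^ (2 - p) * ‖f ω‖ ^ p : ℝ) : ℂ) ∂μ := by
      refine integral_congr_ae ?_
      filter_upwards [hae] with ω hω
      rw [hω, hφ]
      have h1 : ‖f ω‖ ^ 2 * ‖f ω‖ ^ (p - 2) = ‖f ω‖ ^ p := by
        rcases eq_or_ne (f ω) 0 with h | h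
        · simp [h, Real.zero_rpow hp0.ne']
        · rw [← Real.rpow_two, ← Real.rpow_add (norm_pos_iff.2 h)]; congr 1; ring
      rw [← h1]
      push_cast
      rw [← Complex.mul_conj']
      simp only [ContinuousLinearMap.mul_apply']
      ring
    rw [this, integral_complex_ofReal, integral_const_mul, ← Lp_norm_rpow_eq_integral hp0,
      ← Real.rpow_add hf0]
    congr 1
    rw [← Real.rpow_two]; congr 1; ring

theorem Lp_twoConvex {Ω : Type*} [MeasurableSpace Ω] (μ : Measure Ω) {p q : ℝ}
    (hpq : p.HolderConjugate q) [Fact (1 ≤ ENNReal.ofReal p)] [Fact (1 ≤ ENNReal.ofReal q)]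
    {K : ℝ} (hK : 0 < K) (hY : TwoSmooth (Lp ℂ (ENNReal.ofReal q) μ) K) :
    TwoConvex (Lp ℂ (ENNReal.ofReal p) μ) K⁻¹ := by
  have : (ENNReal.ofReal p).HolderConjugate (ENNReal.ofReal q) := hpq.ennrealOfReal
  exact hY.twoConvex_of_norming hK
    ((ContinuousLinearMap.mul ℂ ℂ).lpPairing μ (ENNReal.ofReal p) (ENNReal.ofReal q))
    (norm_lpPairing_mul_le μ) (exists_norming_Lp μ hpq)

/-- Discrete form of the maximum principle: a continuous function with negative second differences
at every interior point lies above its chords. -/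
theorem chord_le_of_second_diff_neg {f : ℝ → ℝ} {a b c : ℝ} (hf : ContinuousOn f (Set.Icc a b))
    (hc : c ∈ Set.Ioo a b)
    (hd : ∀ t ∈ Set.Ioo a b, ∃ h > 0, a ≤ t - h ∧ t + h ≤ b ∧ f (t + h) + f (t - h) - 2 * f t < 0) :
    (b - c) * f a + (c - a) * f b ≤ (b - a) * f c := by
  have hab : a < b := hc.1.trans hc.2
  set ψ : ℝ → ℝ := fun s => (b - a) * f s - (b - s) * f a - (s - a) * f b with hψ
  have hψc : ContinuousOn ψ (Set.Icc a b) := by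
    refine ((continuousOn_const.mul hf).sub ?_).sub ?_ <;> fun_prop
  obtain ⟨t, ht, hmin⟩ := isCompact_Icc.exists_isMinOn (Set.nonempty_Icc.2 hab.le) hψc
  have hcmem : c ∈ Set.Icc a b := ⟨hc.1.le, hc.2.le⟩
  have hle : ψ t ≤ ψ c := hmin hcmem
  have ht0 : ψ t = 0 := by
    rcases ht.1.eq_or_lt with h | h
    · rw [hψ, ← h]; ring
    rcases ht.2.eq_or_lt with h' | h'
    · rw [hψ, h']; ring
    exfalso
    obtain ⟨d, hd0, h1, h2, h3⟩ := hd t ⟨h, h'⟩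
    have m1 : ψ t ≤ ψ (t + d) := hmin (show t + d ∈ Set.Icc a b from ⟨by linarith, h2⟩)
    have m2 : ψ t ≤ ψ (t - d) := hmin (show t - d ∈ Set.Icc a b from ⟨h1, by linarith⟩)
    have e : ψ (t + d) + ψ (t - d) - 2 * ψ t =
        (b - a) * (f (t + d) + f (t - d) - 2 * f t) := by simp only [hψ]; ring
    have := mul_neg_of_pos_of_neg (sub_pos.2 hab) h3
    linarith
  rw [ht0] at hle
  simp only [hψ] at hle
  linarith

theorem log_sub_add_log_add_le {u h : ℝ} (hu : 0 < u) (hh : |h| < u) :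
    Real.log (u - h) + Real.log (u + h) ≤ 2 * Real.log u - h ^ 2 / u ^ 2 := by
  obtain ⟨h1, h2⟩ := abs_lt.1 hh
  have p1 : 0 < u - h := by linarith
  have p2 : 0 < u + h := by linarith
  have := Real.log_le_sub_one_of_pos (show 0 < (u - h) * (u + h) / u ^ 2 by positivity)
  rw [Real.log_div (by positivity) (by positivity), Real.log_mul p1.ne' p2.ne',
    Real.log_pow] at this
  have e : (u - h) * (u + h) / u ^ 2 - 1 = - (h ^ 2 / u ^ 2) := by field_simp; ring
  rw [e] at this
  push_cast at this
  linarith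

theorem neg_div_three_le_one_sub_exp {t : ℝ} (h1 : -2 ≤ t) (h2 : t ≤ 0) :
    -t / 3 ≤ 1 - Real.exp t := by
  have h3 := Real.add_one_le_exp (-t)
  rw [Real.exp_neg] at h3
  have h4 := mul_le_mul_of_nonneg_right h3 (Real.exp_pos t).le
  rw [inv_mul_cancel₀ (Real.exp_pos t).ne'] at h4
  nlinarith [Real.exp_pos t]

section Growth

variable {X : Type*} [NormedAddCommGroup X] [NormedSpace ℂ X] [CompleteSpace X]

/-- If `∑ z ^ j • j • b j` is `O(1 / (1 - |z|))`, then in a 2-uniformly smooth space the square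
means of `∑ z ^ j • b j` grow at most logarithmically. -/
theorem SubexpGrowth.sqMean_le_log {b : ℕ → X} (hb : SubexpGrowth b) {K B : ℝ} (hK : 0 ≤ K)
    (hX : TwoSmooth X K)
    (hB : ∀ t : ℝ, -2 < t → t < 0 → ∀ θ : ℝ,
      ‖expSeries (_root_.derivCoeff b) (t + θ * Complex.I)‖ ≤ B / (-t))
    {t : ℝ} (ht : -1 < t) (ht0 : t < 0) :
    sqMean b t ≤ (4 * K * B ^ 2 + 1) * -Real.log (-t) + 2 * sqMean b (-1) := by
  set κ := 4 * K * B ^ 2 + 1 with hκ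
  have hκ0 : 0 ≤ κ := by positivity
  have hcont : ContinuousOn (fun s => sqMean b s + κ * Real.log (-s)) (Set.Icc (-2) t) := by
    refine ((hb.continuousOn_sqMean ht0).mono fun s hs => hs.2).add
      (continuousOn_const.mul (ContinuousOn.log (by fun_prop) fun s hs => ?_))
    have := hs.2
    linarith
  have key := chord_le_of_second_diff_neg (c := -1) hcont ⟨by norm_num, ht⟩ ?_
  · have e1 : Real.log (- -1 : ℝ) = 0 := by norm_num
    have e2 : 0 ≤ Real.log (- -2 : ℝ) := Real.log_nonneg (by norm_num)
    have e3 := sqMean_nonneg b (-1)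
    have e4 : 0 ≤ (t - -1) * (sqMean b (-2) + κ * Real.log (- -2)) :=
      mul_nonneg (by linarith) (add_nonneg (sqMean_nonneg b _) (mul_nonneg hκ0 e2))
    simp only [e1] at key
    nlinarith
  · intro s hs
    have hs0 : s < 0 := hs.2.trans ht0
    obtain ⟨M, hM⟩ := hb.sqMean_second_diff_le hK hX hs0 (hB s hs.1 hs0)
    have hs2 : 0 < s ^ 2 := by nlinarith
    have hlim : Tendsto (fun h : ℝ => M * h) (nhdsWithin 0 (Set.Ioi 0)) (nhds 0) := by
      have : Tendsto (fun h : ℝ => M * h) (nhds 0) (nhds (M * 0)) :=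
        tendsto_id.const_mul M
      rw [mul_zero] at this
      exact this.mono_left nhdsWithin_le_nhds
    have hsmall : ∀ r : ℝ, 0 < r → ∀ᶠ h in nhdsWithin (0 : ℝ) (Set.Ioi 0), h < r := fun r hr =>
      mem_nhdsWithin_of_mem_nhds (Iio_mem_nhds hr)
    obtain ⟨h, h1, h2, h3, h4, h5, h6⟩ := ((hlim.eventually (gt_mem_nhds
      (show 0 < 1 / s ^ 2 by positivity))).and ((hsmall 1 one_pos).and ((hsmall (-s / 2)
        (by linarith)).and ((hsmall (s + 2) (by linarith [hs.1])).and ((hsmall (t - s)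
          (by linarith [hs.2])).and self_mem_nhdsWithin))))).exists
    have h6 : 0 < h := h6
    refine ⟨h, h6, by linarith, by linarith, ?_⟩
    have d1 := hM h h6 h2.le h3.le
    have d2 := log_sub_add_log_add_le (u := -s) (h := h) (by linarith)
      (by rw [abs_of_pos h6]; linarith)
    have d3 := mul_le_mul_of_nonneg_left d2 hκ0
    have d4 : M * h * h ^ 2 < 1 / s ^ 2 * h ^ 2 := by gcongr
    have d5 : 4 * K * (B / -s) ^ 2 * h ^ 2 + 1 / s ^ 2 * h ^ 2 = κ * (h ^ 2 / (-s) ^ 2) := by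
      rw [hκ]; field_simp
    have e1 : -(s + h) = -s - h := by ring
    have e2 : -(s - h) = -s + h := by ring
    simp only [e1, e2]
    have d6 : M * h ^ 3 = M * h * h ^ 2 := by ring
    linarith

/-- The Cauchy integral formula for the coefficients of `expSeries c`. -/
theorem SubexpGrowth.integral_exp_neg_smul {c : ℕ → X} (hc : SubexpGrowth c) {t : ℝ} (ht : t < 0)
    (N : ℕ) :
    ∫ θ in (0 : ℝ)..2 * Real.pi,
      Complex.exp (-(N * (t + θ * Complex.I))) • expSeries c (t + θ * Complex.I) =
        (2 * Real.pi : ℂ) • c N := by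
  have hsum := intervalIntegral.hasSum_integral_of_dominated_convergence (μ := volume) (a := 0)
    (b := 2 * Real.pi)
    (F := fun (j : ℕ) (θ : ℝ) => Complex.exp (-(N * (t + θ * Complex.I))) •
      Complex.exp (j * (t + θ * Complex.I)) • c j)
    (f := fun θ : ℝ =>
      Complex.exp (-(N * (t + θ * Complex.I))) • expSeries c (t + θ * Complex.I))
    (fun j _ => Real.exp (-(N * t)) * (Real.exp (j * t) * ‖c j‖))
    (fun j => Continuous.aestronglyMeasurable (by fun_prop))
    (fun j => Eventually.of_forall fun θ _ => by
      rw [norm_smul, norm_exp_smul_eq, Complex.norm_exp]; simp)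
    (Eventually.of_forall fun θ _ => (hc t ht).mul_left _)
    (continuous_const.intervalIntegrable _ _)
    (Eventually.of_forall fun θ _ => (hc.hasSum (by simpa using ht)).const_smul _)
  refine hsum.unique ?_
  have hterm : ∀ j : ℕ, ∫ θ in (0 : ℝ)..2 * Real.pi, Complex.exp (-(N * (t + θ * Complex.I))) •
      Complex.exp (j * (t + θ * Complex.I)) • c j =
        if j = N then (2 * Real.pi : ℂ) • c N else 0 := by
    intro j
    have e : ∀ θ : ℝ, Complex.exp (-(N * (t + θ * Complex.I))) •
        Complex.exp (j * (t + θ * Complex.I)) • c j =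
        (Complex.exp (((j : ℂ) - N) * t) * Complex.exp (((j - N : ℤ) : ℂ) * Complex.I * θ)) •
          c j := by
      intro θ
      rw [smul_smul, ← Complex.exp_add, ← Complex.exp_add]
      congr 2
      push_cast; ring
    simp_rw [e]
    rw [intervalIntegral.integral_smul_const, intervalIntegral.integral_const_mul]
    split_ifs with h
    · subst h
      simp
    · have hne : ((j - N : ℤ) : ℂ) * Complex.I ≠ 0 := by
        refine mul_ne_zero ?_ Complex.I_ne_zero
        rw [Int.cast_ne_zero]
        omega
      rw [integral_exp_mul_complex hne]
      have e1 : ((j - N : ℤ) : ℂ) * Complex.I * ((2 * Real.pi : ℝ) : ℂ) =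
          ((j - N : ℤ) : ℂ) * (2 * Real.pi * Complex.I) := by push_cast; ring
      rw [e1, Complex.exp_int_mul_two_pi_mul_I]
      simp
  simp_rw [hterm]
  exact hasSum_ite_eq N _

end Growth

section Kreiss

variable {X : Type*} [NormedAddCommGroup X] [NormedSpace ℂ X]

/-- The coefficients of `-log (1 - z T)`. -/
noncomputable def logCoeff (T : X →L[ℂ] X) (j : ℕ) : X →L[ℂ] X := (j : ℂ)⁻¹ • T ^ j

theorem norm_logCoeff_le (T : X →L[ℂ] X) (j : ℕ) : ‖logCoeff T j‖ ≤ ‖T ^ j‖ := by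
  rw [logCoeff, norm_smul, norm_inv, Complex.norm_natCast]
  refine mul_le_of_le_one_left (norm_nonneg _) ?_
  rcases Nat.eq_zero_or_pos j with rfl | hj
  · simp
  · exact inv_le_one_of_one_le₀ (by exact_mod_cast hj)

theorem SubexpGrowth.logCoeff {T : X →L[ℂ] X} (hT : SubexpGrowth fun j => T ^ j) :
    SubexpGrowth (logCoeff T) := fun t ht =>
  Summable.of_nonneg_of_le (fun _ => by positivity)
    (fun j => mul_le_mul_of_nonneg_left (norm_logCoeff_le T j) (Real.exp_pos _).le) (hT t ht)

theorem SubexpGrowth.apply {A : ℕ → X →L[ℂ] X} (hA : SubexpGrowth A) (x : X) :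
    SubexpGrowth fun j => A j x := fun t ht =>
  Summable.of_nonneg_of_le (fun _ => by positivity)
    (fun j => (mul_le_mul_of_nonneg_left ((A j).le_opNorm x) (Real.exp_pos _).le).trans_eq
      (mul_assoc _ _ _).symm) ((hA t ht).mul_right ‖x‖)

theorem sum_antidiagonal_pow_mul_logCoeff (T : X →L[ℂ] X) (n : ℕ) :
    ∑ kl ∈ antidiagonal n, T ^ kl.1 * logCoeff T kl.2 = (harmonic n : ℂ) • T ^ n := by
  have h1 : ∀ kl ∈ antidiagonal n, T ^ kl.1 * logCoeff T kl.2 = ((kl.2 : ℂ)⁻¹) • T ^ n := by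
    intro kl hkl
    rw [logCoeff, mul_smul_comm, ← pow_add, mem_antidiagonal.1 hkl]
  rw [Finset.sum_congr rfl h1, ← Finset.sum_smul]
  congr 1
  rw [← Finset.Nat.sum_antidiagonal_swap]
  simp only [Prod.snd_swap]
  rw [Finset.Nat.sum_antidiagonal_eq_sum_range_succ (fun i _ => (i : ℂ)⁻¹), Finset.sum_range_succ',
    harmonic]
  simp

theorem harmonic_le_self (n : ℕ) : (harmonic n : ℝ) ≤ n := by
  rw [harmonic]
  push_cast
  calc ∑ i ∈ range n, ((i : ℝ) + 1)⁻¹ ≤ ∑ i ∈ range n, (1 : ℝ) :=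
        Finset.sum_le_sum fun i _ => inv_le_one_of_one_le₀ (by linarith [i.cast_nonneg (α := ℝ)])
    _ = n := by simp

theorem SubexpGrowth.harmonic_smul {b : ℕ → X} (hb : SubexpGrowth b) :
    SubexpGrowth fun n => (harmonic n : ℂ) • b n := fun t ht =>
  Summable.of_nonneg_of_le (fun _ => by positivity) (fun n => by
    have h0 : (0 : ℝ) ≤ harmonic n := by
      rw [harmonic]; push_cast; positivity
    have h1 : ‖(harmonic n : ℂ)‖ ≤ ‖(n : ℂ)‖ := by
      rw [Complex.norm_ratCast, Complex.norm_natCast, abs_of_nonneg h0]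
      exact harmonic_le_self n
    rw [_root_.derivCoeff, norm_smul, norm_smul]
    gcongr) (hb.derivCoeff t ht)

variable [CompleteSpace X]

theorem subexpGrowth_pow {T : X →L[ℂ] X}
    (hT : ∀ lam : ℂ, 1 < ‖lam‖ → IsUnit (lam • (1 : X →L[ℂ] X) - T)) :
    SubexpGrowth fun j => T ^ j := by
  have hrad : spectralRadius ℂ T ≤ 1 := by
    refine iSup₂_le fun k hk => ?_
    by_contra! hlt
    refine hk (spectrum.mem_resolventSet_iff.2 ?_)
    rw [Algebra.algebraMap_eq_smul_one]
    refine hT k ?_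
    have : (1 : NNReal) < ‖k‖₊ := by exact_mod_cast hlt
    exact_mod_cast this
  intro t ht
  have hlt : spectralRadius ℂ T < ENNReal.ofReal (Real.exp (-t / 2)) := by
    refine hrad.trans_lt ?_
    rw [← ENNReal.ofReal_one, ENNReal.ofReal_lt_ofReal_iff (Real.exp_pos _)]
    exact Real.one_lt_exp_iff.2 (by linarith)
  have hev := ((spectrum.pow_norm_pow_one_div_tendsto_nhds_spectralRadius T).eventually
    (gt_mem_nhds hlt)).and (eventually_ge_atTop 1)
  have hgeom : Summable fun j : ℕ => Real.exp (j * (t / 2)) := by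
    have := summable_geometric_of_lt_one (Real.exp_pos (t / 2)).le
      (Real.exp_lt_one_iff.2 (by linarith))
    simpa only [← Real.exp_nat_mul] using this
  refine Summable.of_norm_bounded_eventually_nat hgeom ?_
  filter_upwards [hev] with j hj
  obtain ⟨h1, hj1⟩ := hj
  rw [ENNReal.ofReal_lt_ofReal_iff (Real.exp_pos _)] at h1
  have hj0 : (0 : ℝ) < j := by exact_mod_cast hj1
  have h2 : ‖T ^ j‖ ≤ Real.exp (j * (-t / 2)) := by
    have h3 := Real.rpow_le_rpow (by positivity) h1.le hj0.le
    rwa [← Real.rpow_mul (norm_nonneg _), one_div_mul_cancel hj0.ne', Real.rpow_one,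
      ← Real.exp_mul, mul_comm (-t / 2)] at h3
  rw [Real.norm_of_nonneg (by positivity)]
  calc Real.exp (j * t) * ‖T ^ j‖ ≤ Real.exp (j * t) * Real.exp (j * (-t / 2)) := by gcongr
    _ = _ := by rw [← Real.exp_add]; congr 1; ring

theorem expSeries_apply {A : ℕ → X →L[ℂ] X} (hA : SubexpGrowth A) {ζ : ℂ} (hζ : ζ.re < 0) (x : X) :
    expSeries (fun j => A j x) ζ = expSeries A ζ x :=
  (((hA.hasSum hζ).mapL (ContinuousLinearMap.apply ℂ X x)).tsum_eq : _)

theorem norm_expSeries_pow_le {T : X →L[ℂ] X} {C : ℝ}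
    (hT : ∀ lam : ℂ, 1 < ‖lam‖ → IsUnit (lam • (1 : X →L[ℂ] X) - T) ∧
      ‖Ring.inverse (lam • (1 : X →L[ℂ] X) - T)‖ ≤ C / (‖lam‖ - 1))
    {ζ : ℂ} (hζ : ζ.re < 0) :
    ‖expSeries (fun j => T ^ j) ζ‖ ≤ C / (1 - Real.exp ζ.re) := by
  set z := Complex.exp ζ with hz
  have hz0 : z ≠ 0 := Complex.exp_ne_zero ζ
  have hnz : ‖z‖ = Real.exp ζ.re := Complex.norm_exp ζ
  have hz1 : ‖z‖ < 1 := by rw [hnz]; exact Real.exp_lt_one_iff.2 hζ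
  have hzp : 0 < ‖z‖ := norm_pos_iff.2 hz0
  have hterm : ∀ j : ℕ, Complex.exp (j * ζ) • T ^ j = (z • T) ^ j := fun j => by
    rw [smul_pow, hz, Complex.exp_nat_mul]
  have hgrow := subexpGrowth_pow fun lam hlam => (hT lam hlam).1
  have hs : Summable fun j : ℕ => (z • T) ^ j := by
    have := (hgrow.hasSum hζ).summable
    simpa only [hterm] using this
  set S := expSeries (fun j => T ^ j) ζ with hS
  have hS' : S = ∑' j : ℕ, (z • T) ^ j := by simp only [hS, expSeries, hterm]
  have hlam : 1 < ‖z⁻¹‖ := by rw [norm_inv]; exact (one_lt_inv₀ hzp).2 hz1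
  obtain ⟨hu, hn⟩ := hT z⁻¹ hlam
  have hinv : Ring.inverse (z⁻¹ • (1 : X →L[ℂ] X) - T) = z • S := by
    refine left_inv_eq_right_inv (Ring.inverse_mul_cancel _ hu) ?_
    have e : z⁻¹ • (1 : X →L[ℂ] X) - T = z⁻¹ • (1 - z • T) := by
      rw [smul_sub, smul_smul, inv_mul_cancel₀ hz0, one_smul]
    rw [e, smul_mul_smul_comm, inv_mul_cancel₀ hz0, one_smul, hS']
    exact hs.one_sub_mul_tsum_pow
  rw [hinv, norm_smul, norm_inv] at hn
  rw [← hnz]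
  have h1 : 0 < 1 - ‖z‖ := by linarith
  have e : C / (‖z‖⁻¹ - 1) = ‖z‖ * (C / (1 - ‖z‖)) := by
    have : ‖z‖⁻¹ - 1 = (1 - ‖z‖) / ‖z‖ := by field_simp
    rw [this]; field_simp
  rw [e] at hn
  exact le_of_mul_le_mul_left hn hzp

theorem expSeries_derivCoeff_logCoeff {T : X →L[ℂ] X} (hT : SubexpGrowth fun j => T ^ j) {ζ : ℂ}
    (hζ : ζ.re < 0) (x : X) :
    expSeries (derivCoeff fun j => logCoeff T j x) ζ = expSeries (fun j => T ^ j) ζ x - x := by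
  rw [← expSeries_apply hT hζ]
  refine Eq.trans (tsum_congr fun j => ?_)
    (((hT.apply x).hasSum hζ).sub (hasSum_ite_eq 0 x)).tsum_eq
  rcases eq_or_ne j 0 with rfl | hj
  · simp [derivCoeff]
  · simp [derivCoeff, logCoeff, hj, smul_smul]

theorem expSeries_harmonic_smul_pow {T : X →L[ℂ] X} (hT : SubexpGrowth fun j => T ^ j) {ζ : ℂ}
    (hζ : ζ.re < 0) :
    expSeries (fun n => (harmonic n : ℂ) • T ^ n) ζ =
      expSeries (fun j => T ^ j) ζ * expSeries (logCoeff T) ζ := by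
  simp only [expSeries]
  rw [tsum_mul_tsum_eq_tsum_sum_antidiagonal_of_summable_norm (hT.summable_norm hζ)
    (hT.logCoeff.summable_norm hζ)]
  refine tsum_congr fun n => ?_
  rw [← sum_antidiagonal_pow_mul_logCoeff, Finset.smul_sum]
  refine Finset.sum_congr rfl fun kl hkl => ?_
  rw [smul_mul_smul_comm, ← Complex.exp_add, ← mem_antidiagonal.1 hkl]
  push_cast
  rw [add_mul]

theorem SubexpGrowth.mean_norm_le {b : ℕ → X} (hb : SubexpGrowth b) {t s : ℝ} (ht : t < 0)
    (hs : 0 < s) :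
    (2 * Real.pi)⁻¹ * ∫ θ in (0 : ℝ)..2 * Real.pi, ‖expSeries b (t + θ * Complex.I)‖ ≤
      (sqMean b t / s + s) / 2 := by
  have hpi := Real.pi_pos
  have hc := (hb.continuous_slice ht).norm
  have i1 : IntervalIntegrable (fun θ : ℝ => ‖expSeries b (t + θ * Complex.I)‖ ^ 2) volume 0
      (2 * Real.pi) := (hc.pow 2).intervalIntegrable _ _
  have i2 : IntervalIntegrable (fun _ : ℝ => s / 2) volume 0 (2 * Real.pi) :=
    continuous_const.intervalIntegrable _ _
  have h := intervalIntegral.integral_mono_on (μ := volume) (a := 0) (b := 2 * Real.pi)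
    (by positivity) (hc.intervalIntegrable _ _) ((i1.const_mul (1 / (2 * s))).add i2)
    (fun θ _ => by
      set u := ‖expSeries b (t + θ * Complex.I)‖
      have e : 1 / (2 * s) * u ^ 2 + s / 2 - u = (u - s) ^ 2 / (2 * s) := by field_simp; ring
      have : 0 ≤ (u - s) ^ 2 / (2 * s) := by positivity
      change u ≤ 1 / (2 * s) * u ^ 2 + s / 2
      linarith)
  rw [intervalIntegral.integral_add (i1.const_mul (1 / (2 * s))) i2,
    intervalIntegral.integral_const_mul, intervalIntegral.integral_const, smul_eq_mul,
    sub_zero] at h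
  rw [inv_mul_le_iff₀ (by positivity)]
  refine h.trans_eq ?_
  rw [sqMean]
  set J := ∫ θ in (0 : ℝ)..2 * Real.pi, ‖expSeries b (t + θ * Complex.I)‖ ^ 2
  field_simp

theorem harmonic_mul_norm_pow_apply_le {T : X →L[ℂ] X} {C : ℝ} (hC : 0 ≤ C)
    (hT : ∀ lam : ℂ, 1 < ‖lam‖ → IsUnit (lam • (1 : X →L[ℂ] X) - T) ∧
      ‖Ring.inverse (lam • (1 : X →L[ℂ] X) - T)‖ ≤ C / (‖lam‖ - 1))
    {N : ℕ} (hN : 1 ≤ N) {t : ℝ} (ht : t = -(N : ℝ)⁻¹) (x : X) :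
    (harmonic N : ℝ) * ‖(T ^ N) x‖ ≤ Real.exp 1 * (3 * C * N) * ((2 * Real.pi)⁻¹ *
      ∫ θ in (0 : ℝ)..2 * Real.pi, ‖expSeries (fun j => logCoeff T j x) (t + θ * Complex.I)‖) := by
  have hpi := Real.pi_pos
  have hN0 : (0 : ℝ) < N := by exact_mod_cast hN
  have hN1 : (N : ℝ)⁻¹ ≤ 1 := inv_le_one_of_one_le₀ (by exact_mod_cast hN)
  have ht0 : t < 0 := by rw [ht]; simpa using hN0
  have hgrow := subexpGrowth_pow fun lam hlam => (hT lam hlam).1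
  have hcoef := (hgrow.harmonic_smul.apply x).integral_exp_neg_smul ht0 N
  have hh0 : (0 : ℝ) ≤ harmonic N := by rw [harmonic]; push_cast; positivity
  have hnorm : ‖(2 * Real.pi : ℂ) • ((harmonic N : ℂ) • T ^ N) x‖ =
      2 * Real.pi * ((harmonic N : ℝ) * ‖(T ^ N) x‖) := by
    rw [smul_apply, norm_smul, norm_smul, Complex.norm_ratCast,
      abs_of_nonneg hh0]
    simp [abs_of_pos hpi]
  have hbound : ∀ θ : ℝ, ‖Complex.exp (-(N * (t + θ * Complex.I))) •
      expSeries (fun n => ((harmonic n : ℂ) • T ^ n) x) (t + θ * Complex.I)‖ ≤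
      Real.exp 1 * (3 * C * N) * ‖expSeries (fun j => logCoeff T j x) (t + θ * Complex.I)‖ := by
    intro θ
    set ζ : ℂ := t + θ * Complex.I with hζ
    have hre : ζ.re = t := by simp [hζ]
    have hζ0 : ζ.re < 0 := by rw [hre]; exact ht0
    rw [norm_smul, expSeries_apply hgrow.harmonic_smul hζ0, expSeries_harmonic_smul_pow hgrow hζ0,
      expSeries_apply hgrow.logCoeff hζ0, mul_apply_eq_comp, mul_assoc]
    have e1 : ‖Complex.exp (-(N * ζ))‖ = Real.exp 1 := by
      rw [Complex.norm_exp]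
      congr 1
      have e0 : (N * ζ).re = N * ζ.re := by simp
      rw [Complex.neg_re, e0, hre, ht]
      field_simp
    rw [e1]
    have e2 : ‖expSeries (fun j => T ^ j) ζ‖ ≤ 3 * C * N := by
      refine (norm_expSeries_pow_le hT hζ0).trans ?_
      rw [hre]
      have h1 := neg_div_three_le_one_sub_exp (t := t) (by rw [ht]; linarith) ht0.le
      calc C / (1 - Real.exp t) ≤ C / (-t / 3) := by
            have : 0 < -t / 3 := by linarith
            gcongr
        _ = 3 * C * N := by rw [ht]; field_simp
    gcongr
    exact (ContinuousLinearMap.le_opNorm _ _).trans (by gcongr)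
  have hint := intervalIntegral.norm_integral_le_of_norm_le (μ := volume) (a := 0)
    (b := 2 * Real.pi) (by positivity) (Eventually.of_forall fun θ _ => hbound θ)
    (((hgrow.logCoeff.apply x).continuous_slice ht0).norm.const_mul _ |>.intervalIntegrable _ _)
  rw [hcoef, hnorm, intervalIntegral.integral_const_mul] at hint
  have := mul_le_mul_of_nonneg_left hint (show 0 ≤ (2 * Real.pi)⁻¹ by positivity)
  rw [← mul_assoc, inv_mul_cancel₀ (by positivity), one_mul] at this
  linarith

theorem norm_expSeries_derivCoeff_logCoeff_le {T : X →L[ℂ] X} {C : ℝ} (hC : 0 ≤ C)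
    (hT : ∀ lam : ℂ, 1 < ‖lam‖ → IsUnit (lam • (1 : X →L[ℂ] X) - T) ∧
      ‖Ring.inverse (lam • (1 : X →L[ℂ] X) - T)‖ ≤ C / (‖lam‖ - 1))
    {x : X} (hx : ‖x‖ ≤ 1) {t : ℝ} (ht2 : -2 < t) (ht0 : t < 0) (θ : ℝ) :
    ‖expSeries (derivCoeff fun j => logCoeff T j x) (t + θ * Complex.I)‖ ≤
      (3 * C + 2) / (-t) := by
  have hgrow := subexpGrowth_pow fun lam hlam => (hT lam hlam).1
  have hre : ((t : ℂ) + θ * Complex.I).re = t := by simp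
  have hζ0 : ((t : ℂ) + θ * Complex.I).re < 0 := by rw [hre]; exact ht0
  rw [expSeries_derivCoeff_logCoeff hgrow hζ0]
  have h1 := norm_expSeries_pow_le hT hζ0
  rw [hre] at h1
  have ht' : 0 < -t := by linarith
  have h2 : C / (1 - Real.exp t) ≤ C / (-t / 3) := by
    have := neg_div_three_le_one_sub_exp ht2.le ht0.le
    gcongr
  have h3 : ‖expSeries (fun j => T ^ j) (t + θ * Complex.I) x‖ ≤ C / (-t / 3) :=
    (ContinuousLinearMap.le_opNorm _ _).trans
      ((mul_le_of_le_one_right (norm_nonneg _) hx).trans (h1.trans h2))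
  have h4 : 1 ≤ 2 / (-t) := by rw [le_div_iff₀ ht']; linarith
  have h5 : (3 * C + 2) / (-t) = C / (-t / 3) + 2 / (-t) := by
    have : t ≠ 0 := ht0.ne
    field_simp
    ring
  rw [h5]
  exact (norm_sub_le _ _).trans (add_le_add h3 (hx.trans h4))

theorem sqMean_logCoeff_neg_one_le {T : X →L[ℂ] X} (hT : SubexpGrowth fun j => T ^ j) {x : X}
    (hx : ‖x‖ ≤ 1) :
    sqMean (fun j => logCoeff T j x) (-1) ≤ (∑' j : ℕ, Real.exp (j * (-1)) * ‖T ^ j‖) ^ 2 := by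
  refine (hT.logCoeff.apply x).sqMean_le (by norm_num) fun θ => ?_
  have hre : (((-1 : ℝ) : ℂ) + θ * Complex.I).re = -1 := by simp
  have h := (hT.logCoeff.apply x).norm_expSeries_le (ζ := ((-1 : ℝ) : ℂ) + θ * Complex.I)
    (by rw [hre]; norm_num)
  rw [hre] at h
  refine pow_le_pow_left₀ (norm_nonneg _) (h.trans ?_) 2
  refine Summable.tsum_le_tsum (fun j => ?_) (hT.logCoeff.apply x _ (by norm_num))
    (hT _ (by norm_num))
  gcongr
  exact ((logCoeff T j).le_opNorm x).trans
    ((mul_le_of_le_one_right (norm_nonneg _) hx).trans (norm_logCoeff_le T j))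

end Kreiss

/-- Kreiss bounded operators on 2-uniformly smooth spaces satisfy
`‖T ^ n‖ = O(n / √(log n))`. -/
theorem KreissBounded.isBigO_of_twoSmooth {X : Type} [NormedAddCommGroup X] [NormedSpace ℂ X]
    [CompleteSpace X] {T : X →L[ℂ] X} (hT : KreissBounded T) {K : ℝ} (hK : 0 ≤ K)
    (hX : TwoSmooth X K) :
    (fun n : ℕ => ‖T ^ n‖) =O[atTop] fun n : ℕ => (n : ℝ) / Real.sqrt (Real.log n) := by
  obtain ⟨C, hC, hT⟩ := hT
  have hgrow := subexpGrowth_pow fun lam hlam => (hT lam hlam).1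
  set S := ∑' j : ℕ, Real.exp (j * (-1)) * ‖T ^ j‖ with hS
  set κ := 4 * K * (3 * C + 2) ^ 2 + 1 with hκ
  have hκ0 : 0 ≤ κ := by positivity
  set D := Real.exp 1 * (3 * C) * (κ + 2 * S ^ 2 + 1) / 2 with hD
  refine IsBigO.of_bound D ?_
  filter_upwards [eventually_ge_atTop 3] with N hN
  have hN3 : (3 : ℝ) ≤ N := by exact_mod_cast hN
  have hL : 1 ≤ Real.log N := by
    rw [Real.le_log_iff_exp_le (by linarith)]
    exact (Real.exp_one_lt_d9.le.trans (by norm_num)).trans hN3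
  set L := Real.log N with hLdef
  have hs : 0 < √L := Real.sqrt_pos.2 (by linarith)
  have hsq : √L * √L = L := Real.mul_self_sqrt (by linarith)
  rw [norm_norm, Real.norm_of_nonneg (by positivity)]
  refine ContinuousLinearMap.opNorm_le_of_unit_norm (𝕜 := ℂ) (by positivity) fun x hx => ?_
  have hb := hgrow.logCoeff.apply x
  have ht0 : -(N : ℝ)⁻¹ < 0 := by simp; omega
  have ht1 : -1 < -(N : ℝ)⁻¹ := by
    rw [neg_lt_neg_iff]; exact inv_lt_one_of_one_lt₀ (by linarith)
  have hm := hb.sqMean_le_log hK hX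
    (fun t h1 h2 θ => norm_expSeries_derivCoeff_logCoeff_le hC.le hT hx.le h1 h2 θ) ht1 ht0
  rw [neg_neg, Real.log_inv, neg_neg, ← hκ, ← hLdef] at hm
  have hm1 := sqMean_logCoeff_neg_one_le hgrow hx.le
  rw [← hS] at hm1
  have hmean := hb.mean_norm_le ht0 hs
  have hmain := harmonic_mul_norm_pow_apply_le hC.le hT (by omega) rfl x (N := N)
  have hharm : L ≤ harmonic N := by
    refine le_trans ?_ (log_add_one_le_harmonic N)
    exact Real.log_le_log (by linarith) (by push_cast; linarith)
  have hm2 : sqMean (fun j => logCoeff T j x) (-(N : ℝ)⁻¹) ≤ (κ + 2 * S ^ 2) * L := by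
    nlinarith [sq_nonneg S]
  have hm3 : (sqMean (fun j => logCoeff T j x) (-(N : ℝ)⁻¹) / √L + √L) / 2 ≤
      (κ + 2 * S ^ 2 + 1) * √L / 2 := by
    have : sqMean (fun j => logCoeff T j x) (-(N : ℝ)⁻¹) / √L ≤ (κ + 2 * S ^ 2) * √L := by
      rw [div_le_iff₀ hs, mul_assoc, hsq]; exact hm2
    linarith
  have hfin : L * ‖(T ^ N) x‖ ≤ D * N * √L :=
    calc L * ‖(T ^ N) x‖ ≤ harmonic N * ‖(T ^ N) x‖ := by gcongr
      _ ≤ Real.exp 1 * (3 * C * N) * ((κ + 2 * S ^ 2 + 1) * √L / 2) := by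
          refine hmain.trans ?_
          gcongr
          exact hmean.trans hm3
      _ = D * N * √L := by rw [hD]; ring
  rw [← mul_div_assoc, le_div_iff₀ hs]
  refine le_of_mul_le_mul_right ?_ hs
  calc ‖(T ^ N) x‖ * √L * √L = L * ‖(T ^ N) x‖ := by rw [mul_assoc, hsq, mul_comm]
    _ ≤ _ := hfin

theorem kreiss_bounded_Lp_growth
    {Ω : Type} [MeasurableSpace Ω] (μ : Measure Ω)
    (p : ℝ) (hp1 : 1 < p) [Fact (1 ≤ ENNReal.ofReal p)]
    (T : Lp ℂ (ENNReal.ofReal p) μ →L[ℂ] Lp ℂ (ENNReal.ofReal p) μ)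
    (hT : KreissBounded T) :
    (fun n : ℕ => ‖T ^ n‖) =O[atTop]
      fun n : ℕ => (n : ℝ) / Real.sqrt (Real.log n) := by
  rcases le_total 2 p with hp | hp
  · exact hT.isBigO_of_twoSmooth (Real.exp_pos p).le (Lp_twoSmooth μ hp)
  · have hpq : p.HolderConjugate p.conjExponent := Real.HolderConjugate.conjExponent hp1
    set q := p.conjExponent with hq
    have hq2 : 2 ≤ q := by
      rw [hq, Real.conjExponent, le_div_iff₀ (by linarith)]
      linarith
    have : Fact (1 ≤ ENNReal.ofReal q) := ⟨by
      rw [ENNReal.one_le_ofReal]; linarith⟩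
    have hconv := Lp_twoConvex μ hpq (Real.exp_pos q) (Lp_twoSmooth μ hq2)
    have hdual := hT.dualOp.isBigO_of_twoSmooth (by positivity)
      (hconv.twoSmooth_dual (by positivity))
    refine (IsBigO.of_bound 1 (Eventually.of_forall fun n => ?_)).trans hdual
    rw [norm_norm, norm_norm, one_mul, ← dualOp_pow]
    exact norm_le_norm_dualOp _
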